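/- Under the rich narrative domain with F(ℓ,N^h)>F(h,N^h), the unique essential equilibrium σ* satisfies: (i) σ*(h,N^h,{0})=F(h,N)/F(ℓ,N); (ii) the rest of Supp(σ*) consists exactly of the platforms (ℓ,N^ℓ∖S,S) with S⊆N∖N^h and |S|≥|N∖N^h|−1; moreover σ*(ℓ,N^ℓ∖(N∖N^h),N∖N^h)=α·(F(ℓ,N^h)−F(h,N))/F(h,N) and, for each i∈N∖N^h, σ*(ℓ,N^ℓ∖S_i,S_i)=α·f_i(ℓ)/F(h,N) where S_i=N∖(N^h∪{i}) and α=F(h,N)/F(ℓ,N). -/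

import Mathlib

open Finset
open scoped Classical

/-- A policy: `l` (the "populist" policy ℓ) or `h` (the rational policy). -/
inductive Policy where
  | l : Policy
  | h : Policy
  deriving DecidableEq

instance : Fintype Policy :=
  ⟨{Policy.l, Policy.h}, fun x => by cases x <;> simp⟩

/-- A narrative `S ⊆ {0,…,n}`: the first component records whether the policy
variable (index 0) belongs to `S`, the second records `S ∩ N`. -/
abbrev Narrative (n : ℕ) := Bool × Finset (Fin n)

/-- A platform: a policy, a coalition of social groups, and a narrative. -/
abbrev Platform (n : ℕ) := Policy × Finset (Fin n) × Narrative n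

namespace FN

variable {n : ℕ}

/-- The true narrative `S = {0}`. -/
def trueNarr (n : ℕ) : Narrative n := (true, ∅)

/-- The denialist narrative `S = ∅`. -/
def denialNarr (n : ℕ) : Narrative n := (false, ∅)

/-- `x_S(a,C) = x_S(a',C')`: the variables postulated by the narrative `S` take the
same values at `(a,C)` and `(a',C')`. -/
def Agrees (S : Narrative n) (a : Policy) (C : Finset (Fin n))
    (a' : Policy) (C' : Finset (Fin n)) : Prop :=
  (S.1 = true → a = a') ∧ ∀ i ∈ S.2, (i ∈ C ↔ i ∈ C')

/-- The long-run conditional probability `p_σ(y = 1 ∣ x_S(a,C))`: using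
`Pr(y=1∣h) = q`, `Pr(y=1∣ℓ) = 0`, it is `q` times the σ-mass of platforms with
policy `h` agreeing with `(a,C)` on `S`, divided by the σ-mass of all platforms
agreeing with `(a,C)` on `S`. -/
noncomputable def condProb (q : ℝ) (σ : Platform n → ℝ) (a : Policy)
    (C : Finset (Fin n)) (S : Narrative n) : ℝ :=
  (q * ∑ z ∈ univ.filter (fun z : Platform n =>
      z.1 = Policy.h ∧ Agrees S a C z.1 z.2.1), σ z) /
    ∑ z ∈ univ.filter (fun z : Platform n => Agrees S a C z.1 z.2.1), σ z

/-- The platform payoff `U_σ(a,C,S) = Σ_{i∈C} p_σ(y=1∣x_S(a,C)) · f_i(a)`. -/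
noncomputable def payoff (q : ℝ) (f : Fin n → Policy → ℝ) (σ : Platform n → ℝ)
    (z : Platform n) : ℝ :=
  ∑ i ∈ z.2.1, condProb q σ z.1 z.2.1 z.2.2 * f i z.1

/-- A coalition `C` is admissible given policy `a` if it is a nonempty strict
subset of `N` and every member intrinsically supports `a`. -/
def Admissible (f : Fin n → Policy → ℝ) (a : Policy) (C : Finset (Fin n)) : Prop :=
  C.Nonempty ∧ C ≠ univ ∧ ∀ i ∈ C, 0 < f i a

/-- A valid platform: admissible coalition and feasible narrative. -/
def Valid (f : Fin n → Policy → ℝ) (feas : Narrative n → Prop) (z : Platform n) : Prop :=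
  Admissible f z.1 z.2.1 ∧ feas z.2.2

/-- `σ` is a probability distribution over platforms. -/
def IsDist (σ : Platform n → ℝ) : Prop :=
  (∀ z, 0 ≤ σ z) ∧ ∑ z, σ z = 1

/-- An ε-equilibrium: a full-support distribution (over valid platforms) such that
every platform with probability above ε maximizes the payoff among valid platforms. -/
def EpsEquilibrium (q : ℝ) (f : Fin n → Policy → ℝ) (feas : Narrative n → Prop)
    (ε : ℝ) (σ : Platform n → ℝ) : Prop :=
  IsDist σ ∧ (∀ z, 0 < σ z ↔ Valid f feas z) ∧
    ∀ z, Valid f feas z → ε < σ z →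
      ∀ z', Valid f feas z' → payoff q f σ z' ≤ payoff q f σ z

/-- An equilibrium: a (pointwise) limit of ε-equilibria as ε → 0. -/
def Equilibrium (q : ℝ) (f : Fin n → Policy → ℝ) (feas : Narrative n → Prop)
    (σ : Platform n → ℝ) : Prop :=
  ∃ (ε : ℕ → ℝ) (σs : ℕ → Platform n → ℝ),
    (∀ k, 0 < ε k) ∧ Filter.Tendsto ε Filter.atTop (nhds 0) ∧
    (∀ k, EpsEquilibrium q f feas (ε k) (σs k)) ∧
    (∀ z, Filter.Tendsto (fun k => σs k z) Filter.atTop (nhds (σ z)))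

/-- An essential equilibrium: supported platforms with a false narrative strictly
outperform the true narrative on the same policy-coalition pair, and supported
narratives `S ⊆ N` strictly outperform all strict subset narratives. -/
def Essential (q : ℝ) (f : Fin n → Policy → ℝ) (feas : Narrative n → Prop)
    (σ : Platform n → ℝ) : Prop :=
  Equilibrium q f feas σ ∧
  (∀ a C (S : Narrative n), 0 < σ (a, C, S) → S ≠ trueNarr n →
      payoff q f σ (a, C, trueNarr n) < payoff q f σ (a, C, S)) ∧
  (∀ a C (S : Finset (Fin n)), 0 < σ (a, C, ((false, S) : Narrative n)) →
      ∀ S' : Finset (Fin n), S' ⊂ S →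
        payoff q f σ (a, C, ((false, S') : Narrative n)) <
          payoff q f σ (a, C, ((false, S) : Narrative n)))

/-- `N^a`: the set of groups with positive mobilization potential for `a`. -/
noncomputable def Nset (f : Fin n → Policy → ℝ) (a : Policy) : Finset (Fin n) :=
  univ.filter (fun i => 0 < f i a)

/-- `F(a,M) = Σ_{i∈M} f_i(a)`: the aggregate mobilization potential for `a` in `M`. -/
def Fval (f : Fin n → Policy → ℝ) (a : Policy) (M : Finset (Fin n)) : ℝ :=
  ∑ i ∈ M, f i a

/-- Standing assumptions on the mobilization potentials: nonnegativity, every group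
supports some policy, every policy is supported by some group. -/
def FOK (f : Fin n → Policy → ℝ) : Prop :=
  (∀ i a, 0 ≤ f i a) ∧ (∀ i, ∃ a, 0 < f i a) ∧ (∀ a, ∃ i, 0 < f i a)

/-- Standing assumptions on the family `𝒮` in the fragmented-society model. -/
def FamilyOK (f : Fin n → Policy → ℝ) (𝒮 : Finset (Finset (Fin n))) : Prop :=
  (univ \ Nset f Policy.h).Nonempty ∧ (univ \ Nset f Policy.l).Nonempty ∧
  (Nset f Policy.l ∩ Nset f Policy.h).Nonempty ∧
  univ \ Nset f Policy.h ∈ 𝒮 ∧ univ \ Nset f Policy.l ∈ 𝒮 ∧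
  Nset f Policy.l ∩ Nset f Policy.h ∈ 𝒮 ∧ (∅ : Finset (Fin n)) ∈ 𝒮 ∧
  ∀ S ∈ 𝒮, S ⊆ univ \ Nset f Policy.h ∨ S ⊆ univ \ Nset f Policy.l ∨
    S ⊆ Nset f Policy.l ∩ Nset f Policy.h

/-- In the fragmented-society model, a narrative is feasible iff `S ∖ {0} ∈ 𝒮`. -/
def fragFeas (𝒮 : Finset (Finset (Fin n))) : Narrative n → Prop :=
  fun S => S.2 ∈ 𝒮

end FN

namespace FN

variable {n : ℕ}

/-- The rich narrative domain: all sets of groups weakly contained in `N ∖ N^h`,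
`N ∖ N^ℓ`, or `N^ℓ ∩ N^h` (possibly together with the policy variable). -/
def richFeas (f : Fin n → Policy → ℝ) : Narrative n → Prop := fun S =>
  S.2 ⊆ univ \ Nset f Policy.h ∨ S.2 ⊆ univ \ Nset f Policy.l ∨
    S.2 ⊆ Nset f Policy.l ∩ Nset f Policy.h

end FN


namespace FN

variable {n : ℕ}

noncomputable abbrev Aset (f : Fin n → Policy → ℝ) : Finset (Fin n) := univ \ Nset f Policy.h
noncomputable abbrev Lset (f : Fin n → Policy → ℝ) : Finset (Fin n) := Nset f Policy.l
noncomputable abbrev Hset (f : Fin n → Policy → ℝ) : Finset (Fin n) := Nset f Policy.h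
noncomputable abbrev Mset (f : Fin n → Policy → ℝ) : Finset (Fin n) := Nset f Policy.l ∩ Nset f Policy.h

noncomputable def Hm (σ : Platform n → ℝ) : ℝ :=
  ∑ z ∈ univ.filter (fun z : Platform n => z.1 = Policy.h), σ z
noncomputable def Gm (σ : Platform n → ℝ) (T : Finset (Fin n)) : ℝ :=
  ∑ z ∈ univ.filter (fun z : Platform n => z.1 = Policy.l ∧ Disjoint T z.2.1), σ z
noncomputable def mR (f : Fin n → Policy → ℝ) (σ : Platform n → ℝ) (R : Finset (Fin n)) : ℝ :=
  ∑ z ∈ univ.filter (fun z : Platform n => z.1 = Policy.l ∧ z.2.1 ∩ Aset f = R), σ z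

theorem pol_cases (a : Policy) : a = Policy.l ∨ a = Policy.h := by cases a <;> simp

theorem mem_Nset {f : Fin n → Policy → ℝ} {a i} : i ∈ Nset f a ↔ 0 < f i a := by
  simp [Nset]

theorem payoff_eq (q : ℝ) (f : Fin n → Policy → ℝ) (σ : Platform n → ℝ) (a C S) :
    payoff q f σ (a, C, S) = condProb q σ a C S * Fval f a C := by
  simp [payoff, Fval, mul_sum]

theorem Fval_nonneg {f : Fin n → Policy → ℝ} (hf : FOK f) (a C) : 0 ≤ Fval f a C :=
  sum_nonneg fun i _ => hf.1 i a

theorem Fval_mono {f : Fin n → Policy → ℝ} (hf : FOK f) (a) {C D} (h : C ⊆ D) :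
    Fval f a C ≤ Fval f a D :=
  sum_le_sum_of_subset_of_nonneg h fun i _ _ => hf.1 i a

theorem Fval_lt {f : Fin n → Policy → ℝ} (hf : FOK f) (a) {C D} (h : C ⊂ D)
    (hD : ∀ i ∈ D, 0 < f i a) : Fval f a C < Fval f a D := by
  obtain ⟨i, hi, hi'⟩ := Finset.exists_of_ssubset h
  exact sum_lt_sum_of_subset h.1 hi hi' (hD i hi) fun j _ _ => hf.1 j a

theorem Fval_Nset {f : Fin n → Policy → ℝ} (hf : FOK f) (a) :
    Fval f a (Nset f a) = Fval f a univ := by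
  apply sum_subset (subset_univ _)
  intro i _ hi
  have h1 := hf.1 i a
  rw [mem_Nset] at hi
  linarith

theorem Fval_sdiff {f : Fin n → Policy → ℝ} (a) {C D : Finset (Fin n)} (h : C ⊆ D) :
    Fval f a (D \ C) = Fval f a D - Fval f a C := by
  have := sum_sdiff (f := fun i => f i a) h
  simp only [Fval]; linarith

theorem A_sub_L {f : Fin n → Policy → ℝ} (hf : FOK f) : Aset f ⊆ Lset f := by
  intro i hi
  simp only [mem_sdiff, mem_univ, true_and, mem_Nset] at hi ⊢
  obtain ⟨a, ha⟩ := hf.2.1 i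
  rcases pol_cases a with rfl | rfl
  · exact ha
  · exact absurd ha hi

theorem Fval_l_sdiff {f : Fin n → Policy → ℝ} (hf : FOK f) {T} (hT : T ⊆ Aset f) :
    Fval f Policy.l (Lset f \ T) = Fval f Policy.l univ - Fval f Policy.l T := by
  rw [Fval_sdiff _ (hT.trans (A_sub_L hf)), Fval_Nset hf]

theorem Fval_l_H {f : Fin n → Policy → ℝ} :
    Fval f Policy.l (Hset f) = Fval f Policy.l univ - Fval f Policy.l (Aset f) := by
  have := Fval_sdiff (f := f) Policy.l (subset_univ (Hset f))
  simp only [Aset]; linarith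

section cp
variable {q : ℝ} {σ : Platform n → ℝ}

theorem condProb_le (hq : 0 ≤ q) (hnn : ∀ z, 0 ≤ σ z) (a C S) : condProb q σ a C S ≤ q := by
  unfold condProb
  have h1 : ∑ z ∈ univ.filter (fun z : Platform n =>
      z.1 = Policy.h ∧ Agrees S a C z.1 z.2.1), σ z ≤
      ∑ z ∈ univ.filter (fun z : Platform n => Agrees S a C z.1 z.2.1), σ z := by
    apply sum_le_sum_of_subset_of_nonneg
    · intro z; simp only [mem_filter]; tauto
    · intros; exact hnn _
  have h2 : 0 ≤ ∑ z ∈ univ.filter (fun z : Platform n => Agrees S a C z.1 z.2.1), σ z :=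
    sum_nonneg fun _ _ => hnn _
  apply div_le_of_le_mul₀ h2 hq
  exact mul_le_mul_of_nonneg_left h1 hq

theorem condProb_nonneg (hq : 0 ≤ q) (hnn : ∀ z, 0 ≤ σ z) (a C S) : 0 ≤ condProb q σ a C S :=
  div_nonneg (mul_nonneg hq (sum_nonneg fun _ _ => hnn _)) (sum_nonneg fun _ _ => hnn _)

theorem den_pos (hnn : ∀ z, 0 ≤ σ z) {a C S} {z : Platform n} (hz : 0 < σ z)
    (hag : Agrees S a C z.1 z.2.1) :
    0 < ∑ z ∈ univ.filter (fun z : Platform n => Agrees S a C z.1 z.2.1), σ z :=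
  sum_pos' (fun _ _ => hnn _) ⟨z, by simpa using hag, hz⟩

theorem agrees_self (S : Narrative n) (a C) : Agrees S a C a C := ⟨fun _ => rfl, fun _ _ => Iff.rfl⟩

theorem condProb_true_h {C S} (hS : S.1 = true)
    (hd : 0 < ∑ z ∈ univ.filter (fun z : Platform n => Agrees S Policy.h C z.1 z.2.1), σ z) :
    condProb q σ Policy.h C S = q := by
  unfold condProb
  have : univ.filter (fun z : Platform n => z.1 = Policy.h ∧ Agrees S Policy.h C z.1 z.2.1) =
      univ.filter (fun z : Platform n => Agrees S Policy.h C z.1 z.2.1) := by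
    apply filter_congr
    intro z _
    constructor
    · exact fun h => h.2
    · exact fun h => ⟨(h.1 hS).symm, h⟩
  rw [this]
  exact mul_div_cancel_right₀ _ hd.ne'

theorem condProb_true_l {C S} (hS : S.1 = true) :
    condProb q σ Policy.l C S = 0 := by
  unfold condProb
  have : univ.filter (fun z : Platform n => z.1 = Policy.h ∧ Agrees S Policy.l C z.1 z.2.1) = ∅ := by
    apply filter_eq_empty_iff.2
    rintro z _ ⟨h1, h2⟩
    have := h2.1 hS
    rw [h1] at this
    cases this
  rw [this]
  simp

theorem sum_congr_supp (hnn : ∀ z, 0 ≤ σ z) {P Q : Platform n → Prop} [DecidablePred P] [DecidablePred Q]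
    (h : ∀ z, 0 < σ z → (P z ↔ Q z)) :
    ∑ z ∈ univ.filter P, σ z = ∑ z ∈ univ.filter Q, σ z := by
  rw [sum_filter, sum_filter]
  apply sum_congr rfl
  intro z _
  rcases (hnn z).eq_or_lt with h0 | h0
  · simp [← h0]
  · simp [h z h0]

theorem condProb_congr (hnn : ∀ z, 0 ≤ σ z) {a C S a' C' S'}
    (h : ∀ z, 0 < σ z → (Agrees S a C z.1 z.2.1 ↔ Agrees S' a' C' z.1 z.2.1)) :
    condProb q σ a C S = condProb q σ a' C' S' := by
  unfold condProb
  rw [sum_congr_supp hnn h]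
  rw [sum_congr_supp (P := fun z : Platform n => z.1 = Policy.h ∧ Agrees S a C z.1 z.2.1)
    (Q := fun z : Platform n => z.1 = Policy.h ∧ Agrees S' a' C' z.1 z.2.1) hnn]
  intro z hz
  rw [h z hz]

theorem valid_disj {f : Fin n → Policy → ℝ} {feas} {z : Platform n} (h : Valid f feas z)
    (hz : z.1 = Policy.h) {T} (hT : T ⊆ Aset f) : Disjoint T z.2.1 := by
  rw [disjoint_left]
  intro i hi hi'
  have h1 := h.1.2.2 i hi'
  have h2 := hT hi
  simp only [mem_sdiff, mem_univ, true_and, mem_Nset] at h2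
  rw [hz] at h1
  exact h2 h1

theorem condProb_A {f : Fin n → Policy → ℝ} {feas} (hnn : ∀ z, 0 ≤ σ z)
    (hs : ∀ z, 0 < σ z → Valid f feas z) {T C} (hT : T ⊆ Aset f) (hC : Disjoint T C) :
    condProb q σ Policy.l C (false, T) = q * Hm σ / (Hm σ + Gm σ T) := by
  unfold condProb Hm Gm
  have hA : ∀ z : Platform n, Agrees (false, T) Policy.l C z.1 z.2.1 ↔ Disjoint T z.2.1 := by
    intro z
    simp only [Agrees, disjoint_left] at hC ⊢
    constructor
    · rintro ⟨-, h⟩ i hi hi'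
      exact hC hi ((h i hi).2 hi')
    · intro h
      exact ⟨by simp, fun i hi => iff_of_false (hC hi) (h hi)⟩
  have e1 : ∑ z ∈ univ.filter (fun z : Platform n =>
      z.1 = Policy.h ∧ Agrees (false, T) Policy.l C z.1 z.2.1), σ z =
      ∑ z ∈ univ.filter (fun z : Platform n => z.1 = Policy.h), σ z := by
    apply sum_congr_supp hnn
    intro z hz
    rw [hA]
    exact ⟨fun h => h.1, fun h => ⟨h, valid_disj (hs z hz) h hT⟩⟩
  have e2 : ∑ z ∈ univ.filter (fun z : Platform n =>
      Agrees (false, T) Policy.l C z.1 z.2.1), σ z =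
      ∑ z ∈ univ.filter (fun z : Platform n => z.1 = Policy.h), σ z +
      ∑ z ∈ univ.filter (fun z : Platform n => z.1 = Policy.l ∧ Disjoint T z.2.1), σ z := by
    rw [← sum_union]
    · rw [← filter_or]
      apply sum_congr_supp hnn
      intro z hz
      rw [hA]
      constructor
      · intro h
        rcases pol_cases z.1 with h1 | h1
        · exact Or.inr ⟨h1, h⟩
        · exact Or.inl h1
      · rintro (h | h)
        · exact valid_disj (hs z hz) h hT
        · exact h.2
    · rw [disjoint_left]
      intro z h1 h2
      simp only [mem_filter, mem_univ, true_and] at h1 h2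
      rw [h1] at h2
      cases h2.1
  rw [e1, e2]

end cp

theorem Gm_eq (f : Fin n → Policy → ℝ) (σ : Platform n → ℝ) {T} (hT : T ⊆ Aset f) :
    Gm σ T = ∑ R ∈ (Aset f \ T).powerset, mR f σ R := by
  unfold Gm mR
  rw [← sum_fiberwise_of_maps_to (t := (Aset f \ T).powerset) (g := fun z : Platform n => z.2.1 ∩ Aset f)]
  · apply sum_congr rfl
    intro R hR
    rw [filter_filter]
    apply sum_congr _ (fun _ _ => rfl)
    apply filter_congr
    intro z _
    constructor
    · rintro ⟨⟨h1, -⟩, h2⟩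
      exact ⟨h1, h2⟩
    · rintro ⟨h1, h2⟩
      refine ⟨⟨h1, ?_⟩, h2⟩
      rw [mem_powerset] at hR
      rw [disjoint_left]
      intro i hi hi'
      have : i ∈ R := by rw [← h2]; exact mem_inter.2 ⟨hi', hT hi⟩
      exact (mem_sdiff.1 (hR this)).2 hi
  · intro z hz
    simp only [mem_filter, mem_univ, true_and] at hz
    rw [mem_powerset]
    intro i hi
    rw [mem_inter] at hi
    exact mem_sdiff.2 ⟨hi.2, fun h => disjoint_left.1 hz.2 h hi.1⟩

theorem powerset_split (X : Finset (Fin n)) (g : Finset (Fin n) → ℝ) :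
    ∑ R ∈ X.powerset, g R = g ∅ + ∑ i ∈ X, g {i} +
      ∑ R ∈ X.powerset.filter (fun R => 2 ≤ R.card), g R := by
  rw [← sum_filter_add_sum_filter_not X.powerset (fun R => 2 ≤ R.card), add_comm]
  congr 1
  have : X.powerset.filter (fun R => ¬ 2 ≤ R.card) = insert ∅ (X.image (fun i => {i})) := by
    ext R
    simp only [mem_filter, mem_powerset, mem_insert, mem_image]
    constructor
    · rintro ⟨h1, h2⟩
      rcases (show R.card = 0 ∨ R.card = 1 by omega) with h | h
      · left; exact card_eq_zero.1 h
      · obtain ⟨i, rfl⟩ := card_eq_one.1 h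
        right; exact ⟨i, by simpa using h1, rfl⟩
    · rintro (rfl | ⟨i, hi, rfl⟩)
      · simp
      · simpa using hi
  rw [this, sum_insert (by simp), sum_image]
  intro i _ j _ h
  simpa using h

theorem Hm_add_Gm (σ : Platform n → ℝ) : Hm σ + Gm σ ∅ = ∑ z, σ z := by
  unfold Hm Gm
  rw [← sum_filter_add_sum_filter_not univ (fun z : Platform n => z.1 = Policy.h)]
  congr 2
  apply filter_congr
  intro z _
  rcases pol_cases z.1 with h | h <;> simp [h]

end FN

namespace FN

variable {n : ℕ}

section eqv
variable {q : ℝ} {f : Fin n → Policy → ℝ} {feas : Narrative n → Prop} {σ : Platform n → ℝ}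

theorem eq_basic (he : Equilibrium q f feas σ) :
    (∀ z, 0 ≤ σ z) ∧ ∑ z, σ z = 1 ∧ ∀ z, 0 < σ z → Valid f feas z := by
  obtain ⟨ε, σs, hε, hε0, hE, hc⟩ := he
  refine ⟨fun z => ge_of_tendsto' (hc z) fun k => (hE k).1.1 z, ?_, ?_⟩
  · have h1 : Filter.Tendsto (fun k => ∑ z, σs k z) Filter.atTop (nhds (∑ z, σ z)) :=
      tendsto_finsetSum _ fun z _ => hc z
    have h2 : (fun k => ∑ z, σs k z) = fun _ => 1 := funext fun k => (hE k).1.2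
    rw [h2] at h1
    exact (tendsto_nhds_unique h1 tendsto_const_nhds)
  · intro z hz
    by_contra hv
    have h2 : (fun k => σs k z) = fun _ => 0 := by
      funext k
      have := (hE k).1.1 z
      have h3 := mt ((hE k).2.1 z).1 hv
      linarith
    have h1 := hc z
    rw [h2] at h1
    have := tendsto_nhds_unique h1 tendsto_const_nhds
    linarith

theorem tendsto_payoff {σs : ℕ → Platform n → ℝ}
    (hc : ∀ z, Filter.Tendsto (fun k => σs k z) Filter.atTop (nhds (σ z))) {a C S}
    (hd : 0 < ∑ z ∈ univ.filter (fun z : Platform n => Agrees S a C z.1 z.2.1), σ z) :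
    Filter.Tendsto (fun k => payoff q f (σs k) (a, C, S)) Filter.atTop
      (nhds (payoff q f σ (a, C, S))) := by
  simp only [payoff_eq]
  refine Filter.Tendsto.mul_const _ ?_
  unfold condProb
  refine Filter.Tendsto.div ?_ ?_ hd.ne'
  · exact Filter.Tendsto.const_mul _ (tendsto_finsetSum _ fun z _ => hc z)
  · exact tendsto_finsetSum _ fun z _ => hc z

theorem eq_max (he : Equilibrium q f feas σ) {z} (hz : 0 < σ z) {a C S}
    (hv : Valid f feas (a, C, S))
    (hd : 0 < ∑ z ∈ univ.filter (fun z : Platform n => Agrees S a C z.1 z.2.1), σ z) :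
    payoff q f σ (a, C, S) ≤ payoff q f σ z := by
  obtain ⟨hnn, -, hs⟩ := eq_basic he
  obtain ⟨ε, σs, hε, hε0, hE, hc⟩ := he
  obtain ⟨a', C', S'⟩ := z
  refine le_of_tendsto_of_tendsto (tendsto_payoff hc hd)
    (tendsto_payoff hc (den_pos hnn hz (agrees_self _ _ _))) ?_
  filter_upwards [hε0.eventually_lt (hc _) hz] with k hk
  exact (hE k).2.2 _ (hs _ hz) hk _ hv

theorem eq_lower (he : Equilibrium q f feas σ) {z} (hz : 0 < σ z) {C}
    (hv : Valid f feas (Policy.h, C, trueNarr n)) :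
    q * Fval f Policy.h C ≤ payoff q f σ z := by
  obtain ⟨hnn, -, hs⟩ := eq_basic he
  obtain ⟨ε, σs, hε, hε0, hE, hc⟩ := he
  obtain ⟨a', C', S'⟩ := z
  refine ge_of_tendsto (tendsto_payoff hc (den_pos hnn hz (agrees_self _ _ _))) ?_
  filter_upwards [hε0.eventually_lt (hc _) hz] with k hk
  have := (hE k).2.2 _ (hs _ hz) hk _ hv
  rwa [payoff_eq, condProb_true_h rfl] at this
  exact den_pos (hE k).1.1 (((hE k).2.1 _).2 hv) (agrees_self _ _ _)

end eqv

section chr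
variable {q : ℝ} {f : Fin n → Policy → ℝ} {σ : Platform n → ℝ}

theorem valid_zh (hf : FOK f) (hne1 : (Aset f).Nonempty) :
    Valid f (richFeas f) (Policy.h, Hset f, trueNarr n) := by
  refine ⟨⟨?_, ?_, fun i hi => mem_Nset.1 hi⟩, Or.inl (by simp [trueNarr])⟩
  · obtain ⟨i, hi⟩ := hf.2.2 Policy.h
    exact ⟨i, mem_Nset.2 hi⟩
  · obtain ⟨i, hi⟩ := hne1
    intro h
    have h : Nset f Policy.h = univ := h
    rw [Aset, h] at hi
    simp at hi

theorem valid_l (hne2 : (univ \ Nset f Policy.l).Nonempty) {C S}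
    (hC : C ⊆ Lset f) (hC0 : C.Nonempty) (hS : richFeas f S) :
    Valid f (richFeas f) (Policy.l, C, S) := by
  refine ⟨⟨hC0, ?_, fun i hi => mem_Nset.1 (hC hi)⟩, hS⟩
  obtain ⟨i, hi⟩ := hne2
  rintro h
  have h : C = univ := h
  rw [h] at hC
  simp only [mem_sdiff, mem_univ, true_and] at hi
  exact hi (hC (mem_univ _))

theorem M_sub {T} (hT : T ⊆ Aset f) : Mset f ⊆ Lset f \ T := by
  intro i hi
  rw [mem_inter] at hi
  refine mem_sdiff.2 ⟨hi.1, fun h => ?_⟩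
  have := hT h
  simp only [mem_sdiff] at this
  exact this.2 hi.2

theorem supp_h (hq0 : 0 < q) (hf : FOK f) (hne1 : (Aset f).Nonempty)
    (he : Essential q f (richFeas f) σ) {C S} (hz : 0 < σ (Policy.h, C, S)) :
    C = Hset f ∧ S = trueNarr n := by
  obtain ⟨he, h1, h2⟩ := he
  obtain ⟨hnn, -, hs⟩ := eq_basic he
  have hlow := eq_lower he hz (valid_zh hf hne1)
  have hCH : C ⊆ Hset f := fun i hi => mem_Nset.2 ((hs _ hz).1.2.2 i hi)
  have hle := condProb_le hq0.le hnn Policy.h C S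
  have hC0 := Fval_nonneg hf Policy.h C
  rw [payoff_eq] at hlow
  have hCeq : C = Hset f := by
    by_contra hne
    have := Fval_lt hf Policy.h (hCH.ssubset_of_ne hne) (fun i hi => mem_Nset.1 hi)
    nlinarith
  refine ⟨hCeq, ?_⟩
  by_contra hne
  have h3 := h1 _ _ _ hz hne
  rw [payoff_eq, payoff_eq, condProb_true_h rfl (den_pos hnn hz ⟨fun _ => rfl, by simp⟩)] at h3
  nlinarith

theorem supp_l_pre (hq0 : 0 < q) (hf : FOK f) (hne1 : (Aset f).Nonempty)
    (hne2 : (univ \ Nset f Policy.l).Nonempty)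
    (he : Essential q f (richFeas f) σ) {C S} (hz : 0 < σ (Policy.l, C, S)) :
    0 < σ (Policy.h, Hset f, trueNarr n) ∧ S.1 = false ∧
    ((S.2 ⊆ Aset f ∧ C = Lset f \ S.2) ∨ (S.2 ⊆ Mset f ∧ C = Lset f)) := by
  have he' := he
  obtain ⟨he, h1, h2⟩ := he
  obtain ⟨hnn, -, hs⟩ := eq_basic he
  have hlow := eq_lower he hz (valid_zh hf hne1)
  have hv := hs _ hz
  have hCL : C ⊆ Lset f := fun i hi => mem_Nset.2 (hv.1.2.2 i hi)
  have hF0 : 0 < Fval f Policy.h (Hset f) := by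
    obtain ⟨i, hi⟩ := hf.2.2 Policy.h
    exact sum_pos (fun i hi => mem_Nset.1 hi) ⟨i, mem_Nset.2 hi⟩
  have hpos : 0 < payoff q f σ (Policy.l, C, S) := lt_of_lt_of_le (by positivity) hlow
  rw [payoff_eq] at hpos
  have hcp : 0 < condProb q σ Policy.l C S := by
    have := condProb_nonneg hq0.le hnn Policy.l C S
    rcases this.eq_or_lt with h | h
    · rw [← h] at hpos; simp at hpos
    · exact h
  have hS1 : S.1 = false := by
    by_contra h
    rw [condProb_true_l (by simpa using h)] at hcp
    exact lt_irrefl _ hcp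
  have hex : ∃ z : Platform n, 0 < σ z ∧ z.1 = Policy.h ∧ Agrees S Policy.l C z.1 z.2.1 := by
    by_contra hno
    push Not at hno
    unfold condProb at hcp
    rw [sum_eq_zero] at hcp
    · simp at hcp
    · intro z hz'
      simp only [mem_filter, mem_univ, true_and] at hz'
      rcases (hnn z).eq_or_lt with h | h
      · exact h.symm
      · exact absurd hz'.2 (hno z h hz'.1)
  obtain ⟨⟨a, C', S'⟩, hz', rfl, hag⟩ := hex
  obtain ⟨rfl, rfl⟩ := supp_h hq0 hf hne1 he' hz'
  have key : ∀ D, C ⊆ D → D ⊆ Lset f → (∀ i ∈ S.2, (i ∈ C ↔ i ∈ D)) → C = D := by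
    intro D hCD hDL hi
    by_contra hne
    have hlt := Fval_lt hf Policy.l (hCD.ssubset_of_ne hne) (fun i hi => mem_Nset.1 (hDL hi))
    have hagr : ∀ z : Platform n, Agrees S Policy.l C z.1 z.2.1 ↔ Agrees S Policy.l D z.1 z.2.1 := by
      intro z
      unfold Agrees
      apply and_congr Iff.rfl
      apply forall₂_congr
      intro i hiS
      rw [hi i hiS]
    have := eq_max he hz (valid_l hne2 hDL (hv.1.1.mono hCD) hv.2)
      (den_pos hnn hz ((hagr _).1 (agrees_self _ _ _)))
    rw [payoff_eq, payoff_eq, ← condProb_congr hnn (fun z _ => hagr z)] at this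
    nlinarith
  refine ⟨hz', hS1, ?_⟩
  have hA : S.2 ⊆ Aset f → C = Lset f \ S.2 := by
    intro hSA
    have hn : ∀ i ∈ S.2, i ∉ C := by
      intro i hi hiC
      have := (hag.2 i hi).1 hiC
      exact (mem_sdiff.1 (hSA hi)).2 this
    apply key _ _ sdiff_subset
    · intro i hi; exact iff_of_false (hn i hi) (by simp [hi])
    · intro i hi; exact mem_sdiff.2 ⟨hCL hi, fun h => hn i h hi⟩
  rcases hv.2 with h | h | h
  · exact Or.inl ⟨h, hA h⟩
  · have hemp : S.2 = ∅ := by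
      rw [eq_empty_iff_forall_notMem]
      intro i hi
      have hi2 := h hi
      simp only [mem_sdiff, mem_univ, true_and] at hi2
      have hiC : i ∉ C := fun h' => hi2 (hCL h')
      apply hiC
      apply (hag.2 i hi).2
      by_contra hiH
      exact hi2 (A_sub_L hf (mem_sdiff.2 ⟨mem_univ _, hiH⟩))
    have : S.2 ⊆ Aset f := by rw [hemp]; simp
    exact Or.inl ⟨this, hA this⟩
  · right
    refine ⟨h, key _ hCL subset_rfl ?_⟩
    intro i hi
    have h3 := mem_inter.1 (h hi)
    exact iff_of_true ((hag.2 i hi).2 h3.2) h3.1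

theorem supp_l (hq0 : 0 < q) (hf : FOK f) (hne1 : (Aset f).Nonempty)
    (hne2 : (univ \ Nset f Policy.l).Nonempty)
    (he : Essential q f (richFeas f) σ) {C S} (hz : 0 < σ (Policy.l, C, S)) :
    S.1 = false ∧ S.2 ⊆ Aset f ∧ C = Lset f \ S.2 := by
  obtain ⟨-, hS, h⟩ := supp_l_pre hq0 hf hne1 hne2 he hz
  rcases h with h | ⟨hM, hC⟩
  · exact ⟨hS, h⟩
  rcases S.2.eq_empty_or_nonempty with h0 | h0
  · exact ⟨hS, by simp [h0], by simp [h0, hC]⟩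
  exfalso
  have hall : ∀ z : Platform n, 0 < σ z → Mset f ⊆ z.2.1 := by
    rintro ⟨a, C', S'⟩ hz'
    rcases pol_cases a with rfl | rfl
    · rcases (supp_l_pre hq0 hf hne1 hne2 he hz').2.2 with ⟨h1, h2⟩ | ⟨h1, h2⟩
      · simp only [h2]; exact M_sub h1
      · simp only [h2]; exact inter_subset_left
    · simp only [(supp_h hq0 hf hne1 he hz').1]; exact inter_subset_right
  obtain ⟨he, h1, h2⟩ := he
  obtain ⟨hnn, -, hs⟩ := eq_basic he
  obtain ⟨b, T⟩ := S
  simp only at hS hM h0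
  subst hS
  have := h2 _ _ _ hz ∅ (empty_ssubset.2 h0)
  rw [payoff_eq, payoff_eq, condProb_congr hnn (S' := (false, T)) (a' := Policy.l) (C' := C)] at this
  · exact lt_irrefl _ this
  · intro z hz'
    simp only [Agrees]
    constructor
    · intro _
      exact ⟨by simp, fun i hi => iff_of_true (hall _ hz (hM hi)) (hall _ hz' (hM hi))⟩
    · intro _; simp

end chr

end FN

namespace FN

variable {n : ℕ}

section chr2
variable {q : ℝ} {f : Fin n → Policy → ℝ} {σ : Platform n → ℝ}

theorem richFeas_A {T} (hT : T ⊆ Aset f) : richFeas f (false, T) := Or.inl hT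

theorem A_split {T i} (hi : i ∈ Aset f) (hT : T = univ \ (Nset f Policy.h ∪ {i})) :
    T = Aset f \ {i} := by
  rw [hT]; ext j; simp [Aset, and_comm]

theorem sub_card {S : Finset (Fin n)} (hS : S ⊆ Aset f) (hc : (Aset f).card - 1 ≤ S.card)
    (hne1 : (Aset f).Nonempty) : S = Aset f ∨ ∃ i ∈ Aset f, S = Aset f \ {i} := by
  have h1 := card_sdiff_add_card_eq_card hS
  have h2 := hne1.card_pos
  rcases (show (Aset f \ S).card = 0 ∨ (Aset f \ S).card = 1 by omega) with h | h
  · left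
    rw [card_eq_zero, sdiff_eq_empty_iff_subset] at h
    exact hS.antisymm h
  · right
    obtain ⟨i, hi⟩ := card_eq_one.1 h
    refine ⟨i, ?_, ?_⟩
    · have : i ∈ Aset f \ S := by rw [hi]; simp
      exact (mem_sdiff.1 this).1
    · rw [← hi, sdiff_sdiff_right_self]
      exact (inter_eq_right.2 hS).symm

set_option maxHeartbeats 2000000 in
theorem char (hq0 : 0 < q) (hf : FOK f) (hne1 : (Aset f).Nonempty)
    (hne2 : (univ \ Nset f Policy.l).Nonempty) (hne3 : (Mset f).Nonempty)
    (hpolar : Fval f Policy.h univ < Fval f Policy.l univ - Fval f Policy.l (Aset f))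
    (he : Essential q f (richFeas f) σ) :
    σ (Policy.h, Hset f, trueNarr n) = Fval f Policy.h univ / Fval f Policy.l univ ∧
    (∀ z : Platform n, 0 < σ z → z = (Policy.h, Hset f, trueNarr n) ∨
      ∃ S ⊆ Aset f, (Aset f).card - 1 ≤ S.card ∧
        z = (Policy.l, Lset f \ S, ((false, S) : Narrative n))) ∧
    σ (Policy.l, Lset f \ Aset f, ((false, Aset f) : Narrative n)) =
      (Fval f Policy.l univ - Fval f Policy.l (Aset f) - Fval f Policy.h univ) /
        Fval f Policy.l univ ∧
    ∀ i ∈ Aset f, σ (Policy.l, Lset f \ (Aset f \ {i}), ((false, Aset f \ {i}) : Narrative n)) =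
      f i Policy.l / Fval f Policy.l univ := by
  have he' := he
  obtain ⟨he, h1, h2⟩ := he
  obtain ⟨hnn, hsum, hs⟩ := eq_basic he
  set Φ := Fval f Policy.h univ with hΦ
  set Λ := Fval f Policy.l univ with hΛ
  set W := σ (Policy.h, Hset f, trueNarr n) with hW
  have hΦ0 : 0 < Φ := by
    obtain ⟨i, hi⟩ := hf.2.2 Policy.h
    exact sum_pos' (fun i _ => hf.1 i _) ⟨i, mem_univ _, hi⟩
  have hFA := Fval_nonneg hf Policy.l (Aset f)
  have hΛ0 : 0 < Λ := by linarith
  -- W > 0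
  have hW0 : 0 < W := by
    have : ∃ z, 0 < σ z := by
      by_contra hno
      push Not at hno
      have := sum_nonpos (s := univ) (f := σ) fun z _ => hno z
      linarith
    obtain ⟨⟨a, C, S⟩, hz⟩ := this
    rcases pol_cases a with rfl | rfl
    · exact (supp_l_pre hq0 hf hne1 hne2 he' hz).1
    · obtain ⟨rfl, rfl⟩ := supp_h hq0 hf hne1 he' hz
      exact hz
  have hHm : Hm σ = W := by
    unfold Hm
    rw [sum_eq_single (Policy.h, Hset f, trueNarr n)]
    · rintro ⟨a, C, S⟩ hz hne
      simp only [mem_filter, mem_univ, true_and] at hz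
      subst hz
      rcases (hnn (Policy.h, C, S)).eq_or_lt with h | h
      · exact h.symm
      · obtain ⟨rfl, rfl⟩ := supp_h hq0 hf hne1 he' h
        exact absurd rfl hne
    · intro h; simp at h
  have hmR : ∀ R ⊆ Aset f, mR f σ R =
      σ (Policy.l, Lset f \ (Aset f \ R), ((false, Aset f \ R) : Narrative n)) := by
    intro R hR
    unfold mR
    rw [sum_eq_single (Policy.l, Lset f \ (Aset f \ R), ((false, Aset f \ R) : Narrative n))]
    · rintro ⟨a, C, S⟩ hz hne
      simp only [mem_filter, mem_univ, true_and] at hz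
      obtain ⟨rfl, hz⟩ := hz
      rcases (hnn (Policy.l, C, S)).eq_or_lt with h | h
      · exact h.symm
      · obtain ⟨b, T⟩ := S
        obtain ⟨hb, hT, hC⟩ := supp_l hq0 hf hne1 hne2 he' h
        simp only at hb hT hC
        subst hb
        have hTR : T = Aset f \ R := by
          ext i
          have hiff : i ∈ C ∩ Aset f ↔ i ∈ R := by rw [hz]
          rw [hC, mem_inter, mem_sdiff] at hiff
          have := @hT i
          have := @A_sub_L n f hf i
          rw [mem_sdiff]
          tauto
        subst hTR
        subst hC
        exact absurd rfl hne
    · intro h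
      exfalso
      apply h
      simp only [mem_filter, mem_univ, true_and]
      ext i
      have := @hR i
      have := @A_sub_L n f hf i
      rw [mem_inter, mem_sdiff, mem_sdiff]
      tauto
  have hmRnn : ∀ R, 0 ≤ mR f σ R := fun R => sum_nonneg fun _ _ => hnn _
  have hGnn : ∀ T, 0 ≤ Gm σ T := fun R => sum_nonneg fun _ _ => hnn _
  have hzh_pay : payoff q f σ (Policy.h, Hset f, trueNarr n) = q * Φ := by
    rw [payoff_eq, condProb_true_h rfl (den_pos hnn hW0 (agrees_self _ _ _)), Fval_Nset hf]
  have hpay : ∀ T ⊆ Aset f, ∀ C, Disjoint T C → payoff q f σ (Policy.l, C, ((false, T) : Narrative n)) =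
      q * W / (W + Gm σ T) * Fval f Policy.l C := by
    intro T hT C hC
    rw [payoff_eq, condProb_A hnn hs hT hC, hHm]
  have hden : ∀ T ⊆ Aset f, ∀ C, Disjoint T C → 0 < ∑ z ∈ univ.filter (fun z : Platform n =>
      Agrees ((false, T) : Narrative n) Policy.l C z.1 z.2.1), σ z := by
    intro T hT C hC
    refine den_pos hnn hW0 ⟨by simp, fun i hi => iff_of_false (disjoint_left.1 hC hi) ?_⟩
    exact (mem_sdiff.1 (hT hi)).2
  have hval : ∀ T ⊆ Aset f, Valid f (richFeas f) (Policy.l, Lset f \ T, ((false, T) : Narrative n)) :=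
    fun T hT => valid_l hne2 sdiff_subset (hne3.mono (M_sub hT)) (richFeas_A hT)
  have hle : ∀ T ⊆ Aset f, W * (Λ - Fval f Policy.l T) ≤ Φ * (W + Gm σ T) := by
    intro T hT
    have h := eq_max he hW0 (hval T hT) (hden T hT _ disjoint_sdiff)
    rw [hzh_pay, hpay T hT _ disjoint_sdiff, Fval_l_sdiff hf hT, mul_div_assoc, mul_assoc] at h
    have h := le_of_mul_le_mul_left h hq0
    have hp : 0 < W + Gm σ T := by linarith [hGnn T]
    rw [div_mul_eq_mul_div, div_le_iff₀ hp] at h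
    exact h
  have hge : ∀ T ⊆ Aset f, 0 < σ (Policy.l, Lset f \ T, ((false, T) : Narrative n)) →
      W * (Λ - Fval f Policy.l T) = Φ * (W + Gm σ T) := by
    intro T hT hz
    refine (hle T hT).antisymm ?_
    have h := eq_max he hz (valid_zh hf hne1) (den_pos hnn hW0 (agrees_self _ _ _))
    rw [hzh_pay, hpay T hT _ disjoint_sdiff, Fval_l_sdiff hf hT, mul_div_assoc, mul_assoc] at h
    have h := le_of_mul_le_mul_left h hq0
    have hp : 0 < W + Gm σ T := by linarith [hGnn T]
    rw [div_mul_eq_mul_div, le_div_iff₀ hp] at h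
    exact h
  have hG : ∀ T ⊆ Aset f, Gm σ T = mR f σ ∅ + ∑ i ∈ Aset f \ T, mR f σ {i} +
      ∑ R ∈ (Aset f \ T).powerset.filter (fun R => 2 ≤ R.card), mR f σ R := by
    intro T hT
    rw [Gm_eq f σ hT, powerset_split]
  have hGA : Gm σ (Aset f) = mR f σ ∅ := by
    rw [Gm_eq f σ subset_rfl, sdiff_self, bot_eq_empty, powerset_empty, sum_singleton]
  have hGi : ∀ i ∈ Aset f, Gm σ (Aset f \ {i}) = mR f σ ∅ + mR f σ {i} := by
    intro i hi
    rw [hG _ sdiff_subset, sdiff_sdiff_right_self, inf_eq_inter,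
      inter_eq_right.2 (singleton_subset_iff.2 hi), sum_singleton, sum_eq_zero, add_zero]
    intro R hR
    simp only [mem_filter, mem_powerset] at hR
    have := card_le_card hR.1
    simp at this
    omega
  have hb0 : mR f σ ∅ = σ (Policy.l, Lset f \ Aset f, ((false, Aset f) : Narrative n)) := by
    rw [hmR _ (empty_subset _), sdiff_empty]
  have hAle := hle _ subset_rfl
  rw [hGA] at hAle
  have hA0 : 0 < mR f σ ∅ := by
    by_contra hno
    push Not at hno
    nlinarith
  have hAeq := hge _ subset_rfl (hb0 ▸ hA0)
  rw [hGA] at hAeq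
  have hi0 : ∀ i ∈ Aset f, 0 < mR f σ {i} := by
    intro i hi
    have hss : Aset f \ {i} ⊂ Aset f := by
      refine sdiff_subset.ssubset_of_ne fun h => ?_
      rw [← h] at hi
      simp at hi
    have h := h2 _ _ _ (hb0 ▸ hA0) _ hss
    rw [hpay _ sdiff_subset _ (disjoint_sdiff.mono_left sdiff_subset), hpay _ subset_rfl _ disjoint_sdiff,
      hGA, hGi i hi] at h
    by_contra hno
    have : mR f σ {i} = 0 := le_antisymm (not_lt.1 hno) (hmRnn _)
    rw [this, add_zero] at h
    exact lt_irrefl _ h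
  have hieq : ∀ i ∈ Aset f, Φ * mR f σ {i} = W * f i Policy.l := by
    intro i hi
    have h := hi0 i hi
    rw [hmR _ (singleton_subset_iff.2 hi)] at h
    have h := hge _ sdiff_subset h
    rw [hGi i hi, Fval_sdiff _ (singleton_subset_iff.2 hi)] at h
    have h3 : Fval f Policy.l {i} = f i Policy.l := by simp [Fval]
    rw [h3] at h
    linarith
  have hlow : ∀ T ⊆ Aset f, Φ * (mR f σ ∅ + ∑ i ∈ Aset f \ T, mR f σ {i}) =
      W * (Λ - Fval f Policy.l T) - Φ * W := by
    intro T hT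
    rw [mul_add, mul_sum, sum_congr rfl (fun i hi => hieq i (mem_sdiff.1 hi).1), ← mul_sum]
    have := Fval_sdiff (f := f) Policy.l hT
    change ∑ i ∈ Aset f \ T, f i Policy.l = _ at this
    rw [this]
    linarith
  have hz2 : ∀ R ⊆ Aset f, 2 ≤ R.card → mR f σ R = 0 := by
    intro R hR hc
    by_contra hne
    have hpos := lt_of_le_of_ne (hmRnn R) (Ne.symm hne)
    have hp2 := hpos
    rw [hmR R hR] at hp2
    have h3 := hge _ sdiff_subset hp2
    rw [hG _ sdiff_subset] at h3
    have h4 := hlow (Aset f \ R) sdiff_subset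
    have h5 : mR f σ R ≤ ∑ R ∈ (Aset f \ (Aset f \ R)).powerset.filter (fun R => 2 ≤ R.card), mR f σ R := by
      apply single_le_sum (f := fun R => mR f σ R) (fun R _ => hmRnn R)
      simp only [mem_filter, mem_powerset]
      refine ⟨fun i hi => ?_, hc⟩
      simp only [mem_sdiff, mem_univ, true_and]
      have := hR hi
      simp only [mem_sdiff, mem_univ, true_and] at this
      tauto
    nlinarith
  have hWval : W * Λ = Φ := by
    have h3 := Hm_add_Gm σ
    rw [hsum, hHm, hG _ (empty_subset _)] at h3
    have h4 := hlow ∅ (empty_subset _)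
    rw [sum_eq_zero (s := (Aset f \ ∅).powerset.filter (fun R => 2 ≤ R.card))] at h3
    · have h5 : Fval f Policy.l ∅ = 0 := by simp [Fval]
      rw [h5] at h4
      have h6 : mR f σ ∅ + ∑ i ∈ Aset f \ ∅, mR f σ {i} = 1 - W := by linarith
      rw [h6] at h4
      linarith
    · intro R hR
      simp only [mem_filter, mem_powerset, sdiff_empty] at hR
      exact hz2 R hR.1 hR.2
  have hWeq : W = Φ / Λ := by rw [eq_div_iff hΛ0.ne']; exact hWval
  refine ⟨hWeq, ?_, ?_, ?_⟩
  · rintro ⟨a, C, b, S⟩ hz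
    rcases pol_cases a with rfl | rfl
    · right
      obtain ⟨hb, hS, hC⟩ := supp_l hq0 hf hne1 hne2 he' hz
      simp only at hb hS hC
      subst hb hC
      refine ⟨S, hS, ?_, rfl⟩
      by_contra hno
      have hcard := card_sdiff_add_card_eq_card hS
      have h3 := hz2 (Aset f \ S) sdiff_subset (by omega)
      rw [hmR _ sdiff_subset, sdiff_sdiff_right_self, inf_eq_inter, inter_eq_right.2 hS] at h3
      linarith
    · left
      obtain ⟨rfl, h⟩ := supp_h hq0 hf hne1 he' hz
      rw [h]
  · rw [← hb0, eq_div_iff hΛ0.ne']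
    apply mul_left_cancel₀ hΦ0.ne'
    rw [← hWval] at hAeq ⊢
    have : W * (W * (Λ * (mR f σ ∅ + W))) = W * (W * (Λ - Fval f Policy.l (Aset f))) := by
      rw [hAeq]; ring
    have := mul_left_cancel₀ hW0.ne' this
    linear_combination Λ * this
  · intro i hi
    rw [← hmR _ (singleton_subset_iff.2 hi), eq_div_iff hΛ0.ne']
    have h := hieq i hi
    apply mul_left_cancel₀ hW0.ne'
    rw [← h, ← hWval]; ring

end chr2
end FN

namespace FN

variable {n : ℕ}

noncomputable def Dd (α : ℝ) (σ : Platform n → ℝ) (z : Platform n) : ℝ :=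
  (if z.1 = Policy.h then σ z else 0) - α * σ z

theorem sum_Dd (α : ℝ) (σ : Platform n → ℝ) (P : Platform n → Prop) [DecidablePred P]
    [DecidablePred (fun z : Platform n => z.1 = Policy.h ∧ P z)] :
    ∑ z ∈ univ.filter P, Dd α σ z =
      ∑ z ∈ univ.filter (fun z : Platform n => z.1 = Policy.h ∧ P z), σ z -
        α * ∑ z ∈ univ.filter P, σ z := by
  unfold Dd
  rw [sum_sub_distrib, ← mul_sum, ← sum_filter, filter_filter]
  congr 2
  apply filter_congr
  intro z _
  exact and_comm

theorem condProb_le_alpha {q α : ℝ} {σ : Platform n → ℝ} (hq : 0 ≤ q) (hα : 0 ≤ α)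
    (hnn : ∀ z, 0 ≤ σ z) {a C S}
    (h : ∑ z ∈ univ.filter (fun z : Platform n => Agrees S a C z.1 z.2.1), Dd α σ z ≤ 0) :
    condProb q σ a C S ≤ q * α := by
  rw [sum_Dd] at h
  unfold condProb
  apply div_le_of_le_mul₀ (sum_nonneg fun _ _ => hnn _) (mul_nonneg hq hα)
  rw [mul_assoc]
  apply mul_le_mul_of_nonneg_left _ hq
  linarith

theorem payoff_bound {q : ℝ} {f : Fin n → Policy → ℝ} {σ : Platform n → ℝ} {α W : ℝ}
    (hq0 : 0 < q) (hf : FOK f) 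
    (hnn : ∀ z, 0 ≤ σ z) (hs : ∀ z, 0 < σ z → Valid f (richFeas f) z)
    (hα : α * Fval f Policy.l univ = Fval f Policy.h univ) (hα0 : 0 < α) (hα1 : α ≤ 1)
    (hW : Hm σ = W) (hW0 : 0 < W) (hWα : W ≤ α) (hsum : ∑ z, σ z = 1)
    (hA : ∀ T ⊆ Aset f, W * (Fval f Policy.l univ - Fval f Policy.l T) ≤
      Fval f Policy.h univ * (W + Gm σ T))
    (hM : ∀ E : Finset (Fin n) → Prop, ¬ E (Mset f) →
      ∑ z ∈ univ.filter (fun z : Platform n => E (z.2.1 ∩ Mset f)), Dd α σ z = 0)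
    (z : Platform n) (hz : Valid f (richFeas f) z) :
    payoff q f σ z ≤ q * Fval f Policy.h univ := by
  obtain ⟨a, C, S⟩ := z
  rw [payoff_eq]
  have hC0 := Fval_nonneg hf a C
  have hCU := Fval_mono hf a (subset_univ C)
  have hΦ0 := Fval_nonneg hf Policy.h univ
  rcases pol_cases a with rfl | rfl
  swap
  · have h1 := condProb_le hq0.le hnn Policy.h C S
    calc _ ≤ q * Fval f Policy.h C := mul_le_mul_of_nonneg_right h1 hC0
      _ ≤ _ := mul_le_mul_of_nonneg_left hCU hq0.le
  have hCL : C ⊆ Lset f := fun i hi => mem_Nset.2 (hz.1.2.2 i hi)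
  by_cases hS : S.1 = true
  · rw [condProb_true_l hS, zero_mul]; positivity
  obtain ⟨b, S⟩ := S
  simp only [Bool.not_eq_true] at hS
  subst hS
  have fin : ∑ z ∈ univ.filter (fun z : Platform n =>
        ¬ Agrees ((false, S) : Narrative n) Policy.l C z.1 z.2.1), Dd α σ z ≥ 0 ∨
      ∑ z ∈ univ.filter (fun z : Platform n =>
        Agrees ((false, S) : Narrative n) Policy.l C z.1 z.2.1), Dd α σ z ≤ 0 →
      condProb q σ Policy.l C (false, S) * Fval f Policy.l C ≤ q * Fval f Policy.h univ := by
    intro h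
    have h2 : ∑ z ∈ univ.filter (fun z : Platform n =>
        Agrees ((false, S) : Narrative n) Policy.l C z.1 z.2.1), Dd α σ z ≤ 0 := by
      rcases h with h | h
      · have h3 := sum_filter_add_sum_filter_not univ (fun z : Platform n =>
          Agrees ((false, S) : Narrative n) Policy.l C z.1 z.2.1) (Dd α σ)
        have h4 := sum_Dd α σ (fun _ => True)
        simp only [and_true, filter_true] at h4
        rw [hsum] at h4
        change _ = Hm σ - _ at h4
        linarith
      · exact h
    have h3 := condProb_le_alpha hq0.le hα0.le hnn h2
    calc _ ≤ (q * α) * Fval f Policy.l C := mul_le_mul_of_nonneg_right h3 hC0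
      _ ≤ (q * α) * Fval f Policy.l univ := mul_le_mul_of_nonneg_left hCU (by positivity)
      _ = _ := by rw [mul_assoc, hα]
  rcases hz.2 with h | h | h
  · simp only at h
    by_cases hd : Disjoint S C
    · rw [condProb_A hnn hs h hd, hW]
      have hG : 0 ≤ Gm σ S := sum_nonneg fun _ _ => hnn _
      have h1 : Fval f Policy.l C ≤ Fval f Policy.l univ - Fval f Policy.l S := by
        rw [← Fval_l_sdiff hf h]
        exact Fval_mono hf _ fun i hi => mem_sdiff.2 ⟨hCL hi, fun h' => disjoint_left.1 hd h' hi⟩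
      rw [div_mul_eq_mul_div, div_le_iff₀ (by linarith), mul_assoc, mul_assoc]
      apply mul_le_mul_of_nonneg_left _ hq0.le
      exact (mul_le_mul_of_nonneg_left h1 hW0.le).trans (hA S h)
    · unfold condProb
      rw [sum_eq_zero, mul_zero, zero_div, zero_mul]
      · positivity
      · intro z hz'
        simp only [mem_filter, mem_univ, true_and] at hz'
        rcases (hnn z).eq_or_lt with h0 | h0
        · exact h0.symm
        · exfalso
          apply hd
          have := valid_disj (hs z h0) hz'.1 h
          rw [disjoint_left] at this ⊢
          intro i hi hiC
          exact this hi ((hz'.2.2 i hi).1 hiC)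
  · apply fin
    left
    apply sum_nonneg
    intro z hz'
    simp only [mem_filter, mem_univ, true_and] at hz'
    rcases (hnn z).eq_or_lt with h0 | h0
    · simp [Dd, ← h0]
    · rcases pol_cases z.1 with h1 | h1
      · exfalso
        apply hz'
        refine ⟨by simp, fun i hi => ?_⟩
        have hiL := h hi
        simp only [mem_sdiff, mem_univ, true_and] at hiL
        refine iff_of_false (fun h' => hiL (hCL h')) (fun h' => hiL ?_)
        have := (hs z h0).1.2.2 i h'
        rw [h1] at this
        exact mem_Nset.2 this
      · simp only [Dd, h1, if_true]
        nlinarith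
  · apply fin
    simp only at h
    have hag : ∀ z : Platform n, Agrees ((false, S) : Narrative n) Policy.l C z.1 z.2.1 ↔
        ∀ i ∈ S, (i ∈ C ↔ i ∈ z.2.1 ∩ Mset f) := by
      intro z
      unfold Agrees
      simp only [Bool.false_eq_true, false_implies, true_and]
      apply forall₂_congr
      intro i hi
      rw [mem_inter]
      have := h hi
      tauto
    by_cases hSC : S ⊆ C
    · left
      have h9 := hM (fun D => ¬ ∀ i ∈ S, (i ∈ C ↔ i ∈ D)) (fun hcon =>
        hcon fun i hi => iff_of_true (hSC hi) (h hi))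
      refine ge_of_eq (Eq.trans (sum_congr ?_ fun _ _ => rfl) h9)
      ext z
      simp only [mem_filter, mem_univ, true_and, hag]
    · right
      have h9 := hM (fun D => ∀ i ∈ S, (i ∈ C ↔ i ∈ D)) (fun hcon =>
        hSC fun i hi => (hcon i hi).2 (h hi))
      refine le_of_eq (Eq.trans (sum_congr ?_ fun _ _ => rfl) h9)
      ext z
      simp only [mem_filter, mem_univ, true_and, hag]

end FN

namespace FN

variable {n : ℕ}

noncomputable def al (f : Fin n → Policy → ℝ) : ℝ := Fval f Policy.h univ / Fval f Policy.l univ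
noncomputable def kap (f : Fin n → Policy → ℝ) (R : Finset (Fin n)) : ℝ :=
  if R = ∅ then (Fval f Policy.l univ - Fval f Policy.l (Aset f) - Fval f Policy.h univ) /
    Fval f Policy.h univ else Fval f Policy.l R / Fval f Policy.h univ
noncomputable def zh (f : Fin n → Policy → ℝ) : Platform n := (Policy.h, Hset f, trueNarr n)
noncomputable def zR (f : Fin n → Policy → ℝ) (R : Finset (Fin n)) : Platform n :=
  (Policy.l, Lset f \ (Aset f \ R), ((false, Aset f \ R) : Narrative n))
def SpecL (f : Fin n → Policy → ℝ) (z : Platform n) : Prop :=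
  ∃ R ⊆ Aset f, R.card ≤ 1 ∧ z = zR f R
noncomputable def Kc (f : Fin n → Policy → ℝ) (a : Policy) (P : Finset (Fin n)) : ℝ :=
  ((univ.filter (fun z : Platform n =>
    (z.1 = a ∧ z.2.1 ∩ Mset f = P) ∧ Valid f (richFeas f) z)).card : ℝ)
noncomputable def cw (f : Fin n → Policy → ℝ) (a : Policy) : ℝ :=
  if a = Policy.h then al f else 1 - al f
noncomputable def tau (f : Fin n → Policy → ℝ) (z : Platform n) : ℝ :=
  if Valid f (richFeas f) z ∧ z ≠ zh f ∧ ¬ SpecL f z then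
    (if Mset f ⊆ z.2.1 then 1 else cw f z.1 / Kc f z.1 (z.2.1 ∩ Mset f)) else 0
noncomputable def m2 (f : Fin n → Policy → ℝ) (T : Finset (Fin n)) : ℝ :=
  ∑ R ∈ (Aset f \ T).powerset.filter (fun R => 2 ≤ R.card), mR f (tau f) R
noncomputable def Wd (f : Fin n → Policy → ℝ) (δ : ℝ) : ℝ := al f * (1 - δ * m2 f ∅)
noncomputable def sg (f : Fin n → Policy → ℝ) (δ : ℝ) (z : Platform n) : ℝ :=
  δ * tau f z + (if z = zh f then Wd f δ - δ * Hm (tau f) else 0) +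
    (if SpecL f z then Wd f δ * kap f (z.2.1 ∩ Aset f) - δ * mR f (tau f) (z.2.1 ∩ Aset f) else 0)

structure Hyp (f : Fin n → Policy → ℝ) : Prop where
  hf : FOK f
  h1 : (Aset f).Nonempty
  h2 : (univ \ Nset f Policy.l).Nonempty
  h3 : (Mset f).Nonempty
  hp : Fval f Policy.h univ < Fval f Policy.l univ - Fval f Policy.l (Aset f)

variable {f : Fin n → Policy → ℝ}

theorem Hyp.phi (H : Hyp f) : 0 < Fval f Policy.h univ := by
  obtain ⟨i, hi⟩ := H.hf.2.2 Policy.h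
  exact sum_pos' (fun i _ => H.hf.1 i _) ⟨i, mem_univ _, hi⟩

theorem Hyp.lam (H : Hyp f) : Fval f Policy.h univ < Fval f Policy.l univ := by
  have := Fval_nonneg H.hf Policy.l (Aset f)
  linarith [H.hp]

theorem Hyp.al_pos (H : Hyp f) : 0 < al f := div_pos H.phi (H.phi.trans H.lam)
theorem Hyp.al_lt (H : Hyp f) : al f < 1 := (div_lt_one (H.phi.trans H.lam)).2 H.lam
theorem Hyp.al_mul (H : Hyp f) : al f * Fval f Policy.l univ = Fval f Policy.h univ :=
  div_mul_cancel₀ _ (H.phi.trans H.lam).ne'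

theorem zR_inter (hf : FOK f) {R} (hR : R ⊆ Aset f) : (zR f R).2.1 ∩ Aset f = R := by
  ext i
  have h1 := @hR i
  have h2 := @A_sub_L n f hf i
  simp only [zR]
  rw [mem_inter, mem_sdiff, mem_sdiff]
  tauto

theorem zR_valid (H : Hyp f) (R) : Valid f (richFeas f) (zR f R) :=
  valid_l H.h2 sdiff_subset (H.h3.mono (M_sub sdiff_subset)) (richFeas_A sdiff_subset)

theorem zh_not_specL : ¬ SpecL f (zh f) := by
  rintro ⟨R, -, -, h⟩
  have := congrArg Prod.fst h
  simp [zh, zR] at this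

theorem cw_pos (H : Hyp f) (a) : 0 < cw f a := by
  unfold cw
  split_ifs
  · exact H.al_pos
  · linarith [H.al_lt]

theorem tau_pos (H : Hyp f) {z} (hz : Valid f (richFeas f) z) (h1 : z ≠ zh f) (h2 : ¬ SpecL f z) :
    0 < tau f z := by
  unfold tau
  rw [if_pos ⟨hz, h1, h2⟩]
  split_ifs
  · exact one_pos
  · apply div_pos (cw_pos H _)
    unfold Kc
    rw [Nat.cast_pos, card_pos]
    exact ⟨z, by simp [hz]⟩

theorem tau_zero {z} (hz : ¬ (Valid f (richFeas f) z ∧ z ≠ zh f ∧ ¬ SpecL f z)) : tau f z = 0 := by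
  unfold tau
  rw [if_neg hz]

theorem tau_nn (H : Hyp f) (z) : 0 ≤ tau f z := by
  by_cases h : Valid f (richFeas f) z ∧ z ≠ zh f ∧ ¬ SpecL f z
  · exact (tau_pos H h.1 h.2.1 h.2.2).le
  · rw [tau_zero h]

theorem m2_nn (H : Hyp f) (T) : 0 ≤ m2 f T :=
  sum_nonneg fun _ _ => sum_nonneg fun _ _ => tau_nn H _

theorem Hm_sg (δ : ℝ) : Hm (sg f δ) = Wd f δ := by
  unfold Hm sg
  rw [sum_add_distrib, sum_add_distrib, ← mul_sum, sum_ite_eq' _ (zh f)]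
  rw [sum_eq_zero (f := fun z => if SpecL f z then _ else _)]
  · rw [if_pos (by simp [zh])]
    unfold Hm
    ring
  · intro z hz
    simp only [mem_filter, mem_univ, true_and] at hz
    rw [if_neg]
    rintro ⟨R, -, -, rfl⟩
    simp [zR] at hz

theorem mR_sg (hf : FOK f) (δ : ℝ) {R} (hR : R ⊆ Aset f) :
    mR f (sg f δ) R = if R.card ≤ 1 then Wd f δ * kap f R else δ * mR f (tau f) R := by
  conv_lhs => unfold mR sg
  rw [sum_add_distrib, sum_add_distrib, ← mul_sum, sum_ite_eq' _ (zh f)]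
  rw [if_neg (by simp [zh])]
  have hm : ∑ z ∈ univ.filter (fun z : Platform n => z.1 = Policy.l ∧ z.2.1 ∩ Aset f = R),
    tau f z = mR f (tau f) R := rfl
  rw [hm]
  by_cases hc : R.card ≤ 1
  · rw [if_pos hc, sum_eq_single (zR f R), if_pos ⟨R, hR, hc, rfl⟩, zR_inter hf hR]
    · ring
    · intro z hz hne
      simp only [mem_filter, mem_univ, true_and] at hz
      rw [if_neg]
      rintro ⟨R', hR', -, rfl⟩
      rw [zR_inter hf hR'] at hz
      exact hne (by rw [hz.2])
    · intro h
      exfalso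
      apply h
      simp only [mem_filter, mem_univ, true_and]
      exact ⟨rfl, zR_inter hf hR⟩
  · rw [if_neg hc, sum_eq_zero, add_zero, add_zero]
    intro z hz
    simp only [mem_filter, mem_univ, true_and] at hz
    rw [if_neg]
    rintro ⟨R', hR', hc', rfl⟩
    rw [zR_inter hf hR'] at hz
    exact hc (hz.2 ▸ hc')

theorem kap_sum (X : Finset (Fin n)) : kap f ∅ + ∑ i ∈ X, kap f {i} =
    (Fval f Policy.l univ - Fval f Policy.l (Aset f) - Fval f Policy.h univ + Fval f Policy.l X) /
      Fval f Policy.h univ := by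
  unfold kap
  simp only [if_true, singleton_ne_empty, if_false]
  rw [← sum_div, ← add_div]
  simp [Fval]

theorem Gm_sg (H : Hyp f) (δ : ℝ) {T} (hT : T ⊆ Aset f) :
    Fval f Policy.h univ * (Wd f δ + Gm (sg f δ) T) =
      Wd f δ * (Fval f Policy.l univ - Fval f Policy.l T) +
        Fval f Policy.h univ * (δ * m2 f T) := by
  rw [Gm_eq f _ hT, powerset_split]
  have e1 : ∑ i ∈ Aset f \ T, mR f (sg f δ) {i} = ∑ i ∈ Aset f \ T, Wd f δ * kap f {i} := by
    apply sum_congr rfl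
    intro i hi
    rw [mR_sg H.hf δ (singleton_subset_iff.2 (mem_sdiff.1 hi).1)]
    simp
  have e2 : ∑ R ∈ (Aset f \ T).powerset.filter (fun R => 2 ≤ R.card), mR f (sg f δ) R =
      δ * m2 f T := by
    unfold m2
    rw [mul_sum]
    apply sum_congr rfl
    intro R hR
    simp only [mem_filter, mem_powerset] at hR
    rw [mR_sg H.hf δ (hR.1.trans sdiff_subset), if_neg (by omega)]
  rw [e1, e2, mR_sg H.hf δ (empty_subset _), if_pos (by simp), ← mul_sum, ← mul_add, kap_sum,
    Fval_sdiff _ hT]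
  have := H.phi
  field_simp
  ring

theorem m2_zero {T} (h : (Aset f \ T).card ≤ 1) : m2 f T = 0 := by
  unfold m2
  apply sum_eq_zero
  intro R hR
  simp only [mem_filter, mem_powerset] at hR
  have := card_le_card hR.1
  omega

theorem sum_sg (H : Hyp f) (δ : ℝ) : ∑ z, sg f δ z = 1 := by
  rw [← Hm_add_Gm, Hm_sg]
  have h := Gm_sg H δ (empty_subset (Aset f))
  have h0 : Fval f Policy.l ∅ = 0 := by simp [Fval]
  rw [h0, sub_zero] at h
  apply mul_left_cancel₀ H.phi.ne'
  rw [h]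
  have := H.al_mul
  unfold Wd
  linear_combination (1 - δ * m2 f ∅) * this

theorem exists_valid (H : Hyp f) (a) {P} (hP : P ⊆ Mset f) :
    ∃ z : Platform n, (z.1 = a ∧ z.2.1 ∩ Mset f = P) ∧ Valid f (richFeas f) z := by
  rcases pol_cases a with rfl | rfl
  · refine ⟨(Policy.l, P ∪ Aset f, (false, ∅)), ⟨rfl, ?_⟩, valid_l H.h2 ?_ ?_ (Or.inl (by simp))⟩
    · ext i
      have := @hP i
      simp only [mem_inter, mem_union, mem_sdiff, mem_univ, true_and] at this ⊢
      tauto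
    · exact union_subset (hP.trans inter_subset_left) (A_sub_L H.hf)
    · exact H.h1.mono subset_union_right
  · have hB : univ \ Lset f ⊆ Hset f := by
      intro i hi
      by_contra h
      exact (mem_sdiff.1 hi).2 (A_sub_L H.hf (mem_sdiff.2 ⟨mem_univ _, h⟩))
    have hs : P ∪ (univ \ Lset f) ⊆ Hset f := union_subset (hP.trans inter_subset_right) hB
    refine ⟨(Policy.h, P ∪ (univ \ Lset f), (false, ∅)), ⟨rfl, ?_⟩, ⟨H.h2.mono subset_union_right, ?_, ?_⟩,
      Or.inl (by simp)⟩
    · ext i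
      have := @hP i
      simp only [mem_inter, mem_union, mem_sdiff, mem_univ, true_and] at this ⊢
      tauto
    · intro h
      obtain ⟨i, hi⟩ := H.h1
      have h : P ∪ (univ \ Lset f) = univ := h
      rw [h] at hs
      exact (mem_sdiff.1 hi).2 (hs (mem_univ i))
    · intro i hi
      exact mem_Nset.1 (hs hi)

theorem spec_M {z} (h : z = zh f ∨ SpecL f z) : Mset f ⊆ z.2.1 := by
  rcases h with rfl | ⟨R, hR, -, rfl⟩
  · exact inter_subset_right
  · exact M_sub sdiff_subset

theorem tau_sum (H : Hyp f) (a) {P} (hP : P ⊆ Mset f) (hne : P ≠ Mset f) :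
    ∑ z ∈ univ.filter (fun z : Platform n => z.1 = a ∧ z.2.1 ∩ Mset f = P), tau f z = cw f a := by
  have e : ∀ z ∈ univ.filter (fun z : Platform n => z.1 = a ∧ z.2.1 ∩ Mset f = P),
      tau f z = if Valid f (richFeas f) z then cw f a / Kc f a P else 0 := by
    intro z hz
    simp only [mem_filter, mem_univ, true_and] at hz
    have hns : ¬ Mset f ⊆ z.2.1 := by
      intro h
      rw [inter_eq_right.2 h] at hz
      exact hne hz.2.symm
    have h1 := mt spec_M hns
    push Not at h1
    unfold tau
    simp only [h1, hns, hz, ne_eq, not_false_eq_true, and_true, if_false]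
  rw [sum_congr rfl e, ← sum_filter, filter_filter, sum_const, nsmul_eq_mul]
  change Kc f a P * _ = _
  apply mul_div_cancel₀
  unfold Kc
  obtain ⟨z, hz⟩ := exists_valid H a hP
  have : 0 < (univ.filter (fun z : Platform n =>
    (z.1 = a ∧ z.2.1 ∩ Mset f = P) ∧ Valid f (richFeas f) z)).card :=
    card_pos.2 ⟨z, by simpa using hz⟩
  positivity

theorem sg_nonspec (δ : ℝ) {z} (h : ¬ (z = zh f ∨ SpecL f z)) : sg f δ z = δ * tau f z := by
  push Not at h
  simp [sg, h]

theorem sg_M (H : Hyp f) (δ : ℝ) (E : Finset (Fin n) → Prop) (hE : ¬ E (Mset f)) :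
    ∑ z ∈ univ.filter (fun z : Platform n => E (z.2.1 ∩ Mset f)), Dd (al f) (sg f δ) z = 0 := by
  have e : ∀ z ∈ univ.filter (fun z : Platform n => E (z.2.1 ∩ Mset f)),
      Dd (al f) (sg f δ) z = δ * Dd (al f) (tau f) z := by
    intro z hz
    simp only [mem_filter, mem_univ, true_and] at hz
    have : ¬ (z = zh f ∨ SpecL f z) := by
      intro h
      rw [inter_eq_right.2 (spec_M h)] at hz
      exact hE hz
    unfold Dd
    rw [sg_nonspec δ this]
    split_ifs <;> ring
  rw [sum_congr rfl e, ← mul_sum]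
  apply mul_eq_zero_of_right
  rw [← sum_fiberwise_of_maps_to (t := (Mset f).powerset.filter E)
    (g := fun z : Platform n => z.2.1 ∩ Mset f)]
  · apply sum_eq_zero
    intro P hP
    simp only [mem_filter, mem_powerset] at hP
    have hne : P ≠ Mset f := by rintro rfl; exact hE hP.2
    rw [filter_filter]
    have : univ.filter (fun z : Platform n => E (z.2.1 ∩ Mset f) ∧ z.2.1 ∩ Mset f = P) =
        univ.filter (fun z : Platform n => z.2.1 ∩ Mset f = P) := by
      apply filter_congr
      intro z _
      constructor
      · exact fun h => h.2
      · rintro rfl; exact ⟨hP.2, rfl⟩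
    rw [this, sum_Dd]
    have hs : ∑ z ∈ univ.filter (fun z : Platform n => z.2.1 ∩ Mset f = P), tau f z =
        cw f Policy.h + cw f Policy.l := by
      rw [← tau_sum H Policy.h hP.1 hne, ← tau_sum H Policy.l hP.1 hne,
        ← sum_filter_add_sum_filter_not _ (fun z : Platform n => z.1 = Policy.h),
        filter_filter, filter_filter]
      congr 2
      · apply filter_congr; intro z _; exact and_comm
      · apply filter_congr; intro z _
        rcases pol_cases z.1 with h | h <;> simp [h]
    rw [tau_sum H Policy.h hP.1 hne, hs]
    simp [cw]
  · intro z hz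
    simp only [mem_filter, mem_univ, true_and] at hz
    simp only [mem_filter, mem_powerset]
    exact ⟨inter_subset_right, hz⟩

theorem kap_pos (H : Hyp f) {R} (hR : R ⊆ Aset f) : 0 < kap f R := by
  unfold kap
  split_ifs with h
  · apply div_pos _ H.phi
    linarith [H.hp]
  · apply div_pos _ H.phi
    exact sum_pos (fun i hi => mem_Nset.1 (A_sub_L H.hf (hR hi))) (nonempty_iff_ne_empty.2 h)

theorem Wd_zero : Wd f 0 = al f := by simp [Wd]

theorem sg_zero_pos (H : Hyp f) {z} (h : z = zh f ∨ SpecL f z) : 0 < sg f 0 z := by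
  rcases h with rfl | h
  · simp [sg, zh_not_specL, Wd_zero, H.al_pos]
  · have hne : z ≠ zh f := by rintro rfl; exact zh_not_specL h
    simp only [sg, h, hne, if_true, if_false, Wd_zero]
    obtain ⟨R, hR, -, rfl⟩ := h
    rw [zR_inter H.hf hR]
    have := mul_pos H.al_pos (kap_pos H hR)
    linarith

theorem spec_valid (H : Hyp f) {z} (h : z = zh f ∨ SpecL f z) : Valid f (richFeas f) z := by
  rcases h with rfl | ⟨R, hR, -, rfl⟩
  · exact valid_zh H.hf H.h1
  · exact zR_valid H R

theorem sg_zero_nn (H : Hyp f) (z) : 0 ≤ sg f 0 z := by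
  by_cases h : z = zh f ∨ SpecL f z
  · exact (sg_zero_pos H h).le
  · rw [sg_nonspec 0 h]; simp

theorem sg_zero_supp {z} (hz : 0 < sg f 0 z) : z = zh f ∨ SpecL f z := by
  by_contra h
  rw [sg_nonspec 0 h] at hz
  simp at hz

theorem sg_cont (z) : Continuous fun δ => sg f δ z := by
  unfold sg Wd
  split_ifs <;> fun_prop

theorem ev_supp (H : Hyp f) : ∀ᶠ δ in nhdsWithin (0:ℝ) (Set.Ioi 0),
    0 < Wd f δ ∧ ∀ z, 0 ≤ sg f δ z ∧ (0 < sg f δ z ↔ Valid f (richFeas f) z) := by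
  apply Filter.Eventually.and
  · apply Filter.Eventually.filter_mono nhdsWithin_le_nhds
    have : Continuous (Wd f) := by unfold Wd; fun_prop
    exact this.continuousAt.eventually (lt_mem_nhds (by rw [Wd_zero]; exact H.al_pos))
  · rw [Filter.eventually_all]
    intro z
    by_cases h : z = zh f ∨ SpecL f z
    · apply Filter.Eventually.filter_mono nhdsWithin_le_nhds
      have := (sg_cont (f := f) z).continuousAt.eventually (lt_mem_nhds (sg_zero_pos H h))
      filter_upwards [this] with δ hδ
      exact ⟨hδ.le, fun _ => spec_valid H h, fun _ => hδ⟩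
    · filter_upwards [self_mem_nhdsWithin] with δ hδ
      rw [sg_nonspec δ h]
      have hδ : 0 < δ := hδ
      refine ⟨mul_nonneg hδ.le (tau_nn H z), ?_, ?_⟩
      · intro h2
        by_contra hv
        rw [tau_zero (fun h => hv h.1)] at h2
        simp at h2
      · intro hv
        push Not at h
        exact mul_pos hδ (tau_pos H hv h.1 h.2)

theorem spec_payoff (H : Hyp f) {q δ : ℝ} (hW : 0 < Wd f δ)
    (hnn : ∀ z, 0 ≤ sg f δ z) (hs : ∀ z, 0 < sg f δ z → Valid f (richFeas f) z)
    {z} (hz : 0 < sg f δ z) (h : z = zh f ∨ SpecL f z) :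
    payoff q f (sg f δ) z = q * Fval f Policy.h univ := by
  rcases h with rfl | ⟨R, hR, hc, rfl⟩
  · unfold zh at hz ⊢
    rw [payoff_eq, condProb_true_h rfl (den_pos hnn hz (agrees_self _ _ _)), Fval_Nset H.hf]
  · have hg : 0 ≤ Gm (sg f δ) (Aset f \ R) := sum_nonneg fun _ _ => hnn _
    rw [zR, payoff_eq, condProb_A hnn hs sdiff_subset disjoint_sdiff, Hm_sg,
      Fval_l_sdiff H.hf sdiff_subset, div_mul_eq_mul_div, div_eq_iff (by linarith)]
    have h := Gm_sg H δ (T := Aset f \ R) sdiff_subset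
    rw [m2_zero] at h
    · linear_combination -q * h
    · rw [sdiff_sdiff_right_self, inf_eq_inter, inter_eq_right.2 hR]; exact hc

theorem sg_eps (H : Hyp f) {q δ : ℝ} (hq0 : 0 < q) (hδ : 0 < δ) (hW : 0 < Wd f δ)
    (hh : ∀ z, 0 ≤ sg f δ z ∧ (0 < sg f δ z ↔ Valid f (richFeas f) z)) :
    EpsEquilibrium q f (richFeas f) (δ * (∑ z, tau f z + 1)) (sg f δ) := by
  have hnn := fun z => (hh z).1
  have hs := fun z => (hh z).2.1
  refine ⟨⟨hnn, sum_sg H δ⟩, fun z => (hh z).2, ?_⟩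
  intro z hz hlt z' hz'
  have hspec : z = zh f ∨ SpecL f z := by
    by_contra h
    rw [sg_nonspec δ h] at hlt
    have h1 := lt_of_mul_lt_mul_left hlt hδ.le
    have := single_le_sum (fun z _ => tau_nn H z) (mem_univ z)
    linarith
  rw [spec_payoff H hW hnn hs ((hh z).2.2 hz) hspec]
  refine payoff_bound hq0 H.hf hnn hs H.al_mul H.al_pos H.al_lt.le (Hm_sg δ) hW ?_ (sum_sg H δ)
    ?_ (sg_M H δ) z' hz'
  · have h1 := m2_nn H ∅
    have h2 := H.al_pos
    have h3 : 0 ≤ al f * (δ * m2 f ∅) := by positivity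
    unfold Wd
    linarith
  · intro T hT
    rw [Gm_sg H δ hT]
    have h1 := m2_nn H T
    have h2 := H.phi
    have h3 : 0 ≤ Fval f Policy.h univ * (δ * m2 f T) := by positivity
    linarith

theorem sg_equilibrium (H : Hyp f) {q : ℝ} (hq0 : 0 < q) :
    Equilibrium q f (richFeas f) (sg f 0) := by
  have hev := ev_supp H
  have hseq : Filter.Tendsto (fun k : ℕ => 1 / ((k : ℝ) + 1)) Filter.atTop
      (nhdsWithin (0:ℝ) (Set.Ioi 0)) := by
    rw [tendsto_nhdsWithin_iff]
    refine ⟨tendsto_one_div_add_atTop_nhds_zero_nat, Filter.Eventually.of_forall fun k => ?_⟩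
    exact Set.mem_Ioi.2 (by positivity)
  obtain ⟨K, hK⟩ := Filter.eventually_atTop.1 (hseq.eventually hev)
  set d : ℕ → ℝ := fun k => 1 / (((k + K : ℕ) : ℝ) + 1) with hd
  have hd0 : ∀ k, 0 < d k := fun k => by simp only [hd]; positivity
  have hdt : Filter.Tendsto d Filter.atTop (nhds 0) :=
    (Filter.tendsto_add_atTop_iff_nat (f := fun k : ℕ => 1 / ((k : ℝ) + 1)) K).2
      tendsto_one_div_add_atTop_nhds_zero_nat
  have hT : 0 < ∑ z, tau f z + 1 := by
    have := sum_nonneg (s := univ) (fun z _ => tau_nn H z)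
    linarith
  refine ⟨fun k => d k * (∑ z, tau f z + 1), fun k => sg f (d k), fun k => mul_pos (hd0 k) hT, ?_, ?_, ?_⟩
  · simpa using hdt.mul_const (∑ z, tau f z + 1)
  · intro k
    have := hK (k + K) (by omega)
    exact sg_eps H hq0 (hd0 k) this.1 this.2
  · intro z
    exact ((sg_cont (f := f) z).tendsto 0).comp hdt

theorem sg_essential (H : Hyp f) {q : ℝ} (hq0 : 0 < q) :
    Essential q f (richFeas f) (sg f 0) := by
  have hnn := sg_zero_nn H
  have hs : ∀ z, 0 < sg f 0 z → Valid f (richFeas f) z := fun z hz => spec_valid H (sg_zero_supp hz)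
  have hW : 0 < Wd f 0 := by rw [Wd_zero]; exact H.al_pos
  refine ⟨sg_equilibrium H hq0, ?_, ?_⟩
  · intro a C S hz hne
    have h := sg_zero_supp hz
    rw [spec_payoff H hW hnn hs hz h]
    rcases h with h | ⟨R, hR, hc, h⟩
    · simp only [zh, Prod.mk.injEq] at h
      exact absurd h.2.2 hne
    · simp only [zR, Prod.mk.injEq] at h
      rw [h.1, payoff_eq, condProb_true_l rfl, zero_mul]
      exact mul_pos hq0 H.phi
  · intro a C S hz S' hS'
    rcases sg_zero_supp hz with h | ⟨R, hR, hc, h⟩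
    · simp [zh, trueNarr] at h
    · simp only [zR, Prod.mk.injEq, true_and] at h
      obtain ⟨rfl, rfl, rfl⟩ := h
      have hd : Disjoint (Aset f \ R) (Lset f \ (Aset f \ R)) := disjoint_sdiff
      rw [payoff_eq, payoff_eq, condProb_A hnn hs (hS'.1.trans sdiff_subset) (hd.mono_left hS'.1),
        condProb_A hnn hs sdiff_subset hd, Hm_sg]
      have hF : 0 < Fval f Policy.l (Lset f \ (Aset f \ R)) :=
        sum_pos (fun i hi => mem_Nset.1 (mem_sdiff.1 hi).1) (H.h3.mono (M_sub sdiff_subset))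
      have hg : 0 ≤ Gm (sg f 0) (Aset f \ R) := sum_nonneg fun _ _ => hnn _
      apply mul_lt_mul_of_pos_right _ hF
      apply div_lt_div_of_pos_left (by positivity) (by positivity)
      apply add_lt_add_right
      obtain ⟨i, hi, hi'⟩ := exists_of_ssubset hS'
      have hiA := (mem_sdiff.1 hi).1
      have hspec : SpecL f (zR f {i}) := ⟨{i}, singleton_subset_iff.2 hiA, by simp, rfl⟩
      have hin := zR_inter H.hf (singleton_subset_iff.2 hiA)
      have hmem : ∀ j ∈ Aset f, (j ∈ (zR f {i}).2.1 ↔ j = i) := by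
        intro j hj
        have h9 : j ∈ (zR f {i}).2.1 ∩ Aset f ↔ j ∈ ({i} : Finset (Fin n)) := by rw [hin]
        rw [mem_inter, mem_singleton] at h9
        tauto
      unfold Gm
      apply sum_lt_sum_of_subset (i := zR f {i})
      · intro z hz
        simp only [mem_filter, mem_univ, true_and] at hz ⊢
        exact ⟨hz.1, hz.2.mono_left hS'.1⟩
      · simp only [mem_filter, mem_univ, true_and]
        refine ⟨rfl, disjoint_left.2 fun j hj hj' => hi' ?_⟩
        rw [← (hmem j (mem_sdiff.1 (hS'.1 hj)).1).1 hj']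
        exact hj
      · simp only [mem_filter, mem_univ, true_and]
        rintro ⟨-, h⟩
        exact disjoint_left.1 h hi ((hmem i hiA).2 rfl)
      · exact sg_zero_pos H (Or.inr hspec)
      · intro z _ _; exact hnn z

end FN

/-- Under the rich narrative domain with `F(ℓ,N^h) > F(h,N^h)`, the
unique essential equilibrium `σ*` satisfies: (i) `σ*(h,N^h,{0}) = F(h,N)/F(ℓ,N)`;
(ii) the rest of the support of `σ*` consists exactly of the platforms
`(ℓ, N^ℓ∖S, S)` with `S ⊆ N∖N^h` and `|S| ≥ |N∖N^h| − 1`; moreover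
`σ*(ℓ, N^ℓ∖(N∖N^h), N∖N^h) = α·(F(ℓ,N^h) − F(h,N))/F(h,N)` and, for each
`i ∈ N∖N^h`, `σ*(ℓ, N^ℓ∖S_i, S_i) = α·f_i(ℓ)/F(h,N)` where
`S_i = N∖(N^h∪{i})` and `α = F(h,N)/F(ℓ,N)`. -/
theorem rich_domain_equilibrium
    (n : ℕ) (q : ℝ) (hq0 : 0 < q) (hq1 : q ≤ 1)
    (f : Fin n → Policy → ℝ) (hf : FN.FOK f)
    (hne1 : (univ \ FN.Nset f Policy.h).Nonempty)
    (hne2 : (univ \ FN.Nset f Policy.l).Nonempty)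
    (hne3 : (FN.Nset f Policy.l ∩ FN.Nset f Policy.h).Nonempty)
    (hpolar : FN.Fval f Policy.h (FN.Nset f Policy.h) <
      FN.Fval f Policy.l (FN.Nset f Policy.h)) :
    (∃ σ : Platform n → ℝ, FN.Essential q f (FN.richFeas f) σ ∧
        ∀ σ' : Platform n → ℝ, FN.Essential q f (FN.richFeas f) σ' → σ' = σ) ∧
    ∀ σ : Platform n → ℝ, FN.Essential q f (FN.richFeas f) σ →
      σ (Policy.h, FN.Nset f Policy.h, FN.trueNarr n) =
        FN.Fval f Policy.h univ / FN.Fval f Policy.l univ ∧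
      (∀ z : Platform n, 0 < σ z →
          z = (Policy.h, FN.Nset f Policy.h, FN.trueNarr n) ∨
          ∃ S : Finset (Fin n), S ⊆ univ \ FN.Nset f Policy.h ∧
            (univ \ FN.Nset f Policy.h).card - 1 ≤ S.card ∧
            z = (Policy.l, FN.Nset f Policy.l \ S, ((false, S) : Narrative n))) ∧
      (∀ S : Finset (Fin n), S ⊆ univ \ FN.Nset f Policy.h →
          (univ \ FN.Nset f Policy.h).card - 1 ≤ S.card →
          0 < σ (Policy.l, FN.Nset f Policy.l \ S, ((false, S) : Narrative n))) ∧
      σ (Policy.l, FN.Nset f Policy.l \ (univ \ FN.Nset f Policy.h),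
          ((false, univ \ FN.Nset f Policy.h) : Narrative n)) =
        (FN.Fval f Policy.h univ / FN.Fval f Policy.l univ) *
          (FN.Fval f Policy.l (FN.Nset f Policy.h) - FN.Fval f Policy.h univ) /
          FN.Fval f Policy.h univ ∧
      ∀ i ∈ univ \ FN.Nset f Policy.h,
        σ (Policy.l, FN.Nset f Policy.l \ (univ \ (FN.Nset f Policy.h ∪ {i})),
            ((false, univ \ (FN.Nset f Policy.h ∪ {i})) : Narrative n)) =
          (FN.Fval f Policy.h univ / FN.Fval f Policy.l univ) * f i Policy.l /
            FN.Fval f Policy.h univ := by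
  have hpolar' : FN.Fval f Policy.h univ <
      FN.Fval f Policy.l univ - FN.Fval f Policy.l (FN.Aset f) := by
    rw [← FN.Fval_l_H, ← FN.Fval_Nset hf]; exact hpolar
  have H : FN.Hyp f := ⟨hf, hne1, hne2, hne3, hpolar'⟩
  have ch := fun σ (he : FN.Essential q f (FN.richFeas f) σ) =>
    FN.char hq0 hf hne1 hne2 hne3 hpolar' he
  have hΦ := H.phi
  have hΛ : 0 < FN.Fval f Policy.l univ := hΦ.trans H.lam
  refine ⟨⟨FN.sg f 0, FN.sg_essential H hq0, ?_⟩, ?_⟩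
  · intro σ' he
    have he2 := FN.sg_essential H hq0
    obtain ⟨a1, a2, a3, a4⟩ := ch _ he
    obtain ⟨b1, b2, b3, b4⟩ := ch _ he2
    have n1 := (FN.eq_basic he.1).1
    have n2 := (FN.eq_basic he2.1).1
    have key : ∀ z, (z = (Policy.h, FN.Hset f, FN.trueNarr n) ∨
        ∃ S ⊆ FN.Aset f, (FN.Aset f).card - 1 ≤ S.card ∧
        z = (Policy.l, FN.Lset f \ S, ((false, S) : Narrative n))) → σ' z = FN.sg f 0 z := by
      rintro z (rfl | ⟨S, hS, hc, rfl⟩)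
      · rw [a1, b1]
      · rcases FN.sub_card hS hc hne1 with rfl | ⟨i, hi, rfl⟩
        · rw [a3, b3]
        · rw [a4 i hi, b4 i hi]
    funext z
    rcases (n1 z).eq_or_lt with h | h
    · rcases (n2 z).eq_or_lt with h' | h'
      · rw [← h, ← h']
      · exact key z (b2 z h')
    · exact key z (a2 z h)
  · intro σ he
    obtain ⟨a1, a2, a3, a4⟩ := ch _ he
    refine ⟨a1, ?_, ?_, ?_, ?_⟩
    · intro z hz
      rcases a2 z hz with h | ⟨S, hS, hc, h⟩
      · exact Or.inl h
      · exact Or.inr ⟨S, hS, hc, h⟩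
    · intro S hS hc
      rcases FN.sub_card hS hc hne1 with rfl | ⟨i, hi, rfl⟩
      · refine lt_of_lt_of_eq ?_ a3.symm
        exact div_pos (by linarith) hΛ
      · refine lt_of_lt_of_eq ?_ (a4 i hi).symm
        exact div_pos (FN.mem_Nset.1 (FN.A_sub_L hf hi)) hΛ
    · refine a3.trans ?_
      rw [← FN.Fval_l_H]
      field_simp
    · intro i hi
      rw [FN.A_split hi rfl]
      refine (a4 i hi).trans ?_
      field_simp
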